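/- arXiv:2210.05927 — 4 statements merged into one kernel-verified Lean document; each statement's English description precedes it below -/
import Mathlib

section
/- For all Q₁, Q₂ : S × A → ℝ, ‖T̲Q₁ − T̲Q₂‖∞ ≤ γ · ‖Q₁ − Q₂‖∞. In particular, since γ ∈ [0,1), the worst-attack Bellman operator T̲ is a γ-contraction in the sup norm. -/
open Finset

theorem Finset.abs_inf'_sub_inf'_le {ι : Type*} {s : Finset ι} (hs : s.Nonempty)
    {f g : ι → ℝ} {c : ℝ} (h : ∀ i ∈ s, |f i - g i| ≤ c) :
    |s.inf' hs f - s.inf' hs g| ≤ c := by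
  obtain ⟨i, hi, hfi⟩ := s.exists_mem_eq_inf' hs f
  obtain ⟨j, hj, hgj⟩ := s.exists_mem_eq_inf' hs g
  have hf := s.inf'_le f hj
  have hg := s.inf'_le g hi
  have h₁ := abs_le.mp (h i hi)
  have h₂ := abs_le.mp (h j hj)
  rw [abs_le]
  constructor <;> linarith

theorem Finset.abs_sum_mul_le_of_sum_eq_one {ι : Type*} {s : Finset ι} {w f : ι → ℝ} {c : ℝ}
    (hw0 : ∀ i ∈ s, 0 ≤ w i) (hw1 : ∑ i ∈ s, w i = 1) (hf : ∀ i ∈ s, |f i| ≤ c) :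
    |∑ i ∈ s, w i * f i| ≤ c :=
  calc |∑ i ∈ s, w i * f i| ≤ ∑ i ∈ s, |w i * f i| := abs_sum_le_sum_abs _ _
    _ ≤ ∑ i ∈ s, w i * c := sum_le_sum fun i hi => by
        rw [abs_mul, abs_of_nonneg (hw0 i hi)]
        exact mul_le_mul_of_nonneg_left (hf i hi) (hw0 i hi)
    _ = c := by rw [← sum_mul, hw1, one_mul]

/-- The worst-attack Bellman operator is a `γ`-contraction in the sup norm:
`‖T̲Q₁ − T̲Q₂‖∞ ≤ γ · ‖Q₁ − Q₂‖∞`. -/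
theorem worstAttackBellman_contraction
    {S A : Type*} [Fintype S] [Fintype A] [Nonempty S] [Nonempty A]
    (P : S → A → S → ℝ) (R : S → A → ℝ) (γ : ℝ)
    (hP0 : ∀ s a s', 0 ≤ P s a s') (hP1 : ∀ s a, ∑ s', P s a s' = 1)
    (hγ0 : 0 ≤ γ) (hγ1 : γ < 1)
    (Aadv : S → Finset A) (hAadv : ∀ s, (Aadv s).Nonempty)
    (T : (S → A → ℝ) → (S → A → ℝ))
    (hT : ∀ Q s a, T Q s a =
      R s a + γ * ∑ s', P s a s' * (Aadv s').inf' (hAadv s') (Q s'))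
    (Q₁ Q₂ : S → A → ℝ) :
    (univ : Finset (S × A)).sup' univ_nonempty
        (fun sa => |T Q₁ sa.1 sa.2 - T Q₂ sa.1 sa.2|) ≤
      γ * (univ : Finset (S × A)).sup' univ_nonempty
        (fun sa => |Q₁ sa.1 sa.2 - Q₂ sa.1 sa.2|) := by
  refine sup'_le _ _ fun sa _ => ?_
  rw [hT, hT, add_sub_add_left_eq_sub, ← mul_sub, ← sum_sub_distrib, abs_mul, abs_of_nonneg hγ0]
  refine mul_le_mul_of_nonneg_left ?_ hγ0
  simp only [← mul_sub]
  refine abs_sum_mul_le_of_sum_eq_one (fun s' _ => hP0 _ _ s') (hP1 _ _) fun s' _ => ?_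
  exact abs_inf'_sub_inf'_le _ fun a _ =>
    le_sup' (fun sa : S × A => |Q₁ sa.1 sa.2 - Q₂ sa.1 sa.2|) (mem_univ (s', a))
end

section
/- Let Q̲ be the unique fixed point of the worst-attack Bellman operator T̲. Then for every admissible selector σ : S → A (i.e., σ(s) ∈ A_adv(s) for all s), the unique fixed point Q^σ of the policy-evaluation operator T_σ satisfies Q̲(s,a) ≤ Q^σ(s,a) for all (s,a) ∈ S × A. That is, the fixed point of the worst-attack Bellman operator is a pointwise lower bound on the value of the policy under every admissible attacker. -/
open Finset

/-- The fixed point of the worst-attack Bellman operator is a pointwise lower bound on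
the value of the policy under every admissible attacker. -/
theorem worstAttackFixedPoint_le_admissible_selector_value
    {S A : Type*} [Fintype S] [Fintype A] [Nonempty S] [Nonempty A]
    (P : S → A → S → ℝ) (R : S → A → ℝ) (γ : ℝ)
    (hP0 : ∀ s a s', 0 ≤ P s a s') (hP1 : ∀ s a, ∑ s', P s a s' = 1)
    (hγ0 : 0 ≤ γ) (hγ1 : γ < 1)
    (Aadv : S → Finset A) (hAadv : ∀ s, (Aadv s).Nonempty)
    (T : (S → A → ℝ) → (S → A → ℝ))
    (hT : ∀ Q s a, T Q s a =
      R s a + γ * ∑ s', P s a s' * (Aadv s').inf' (hAadv s') (Q s'))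
    (Qb : S → A → ℝ) (hQb : T Qb = Qb)
    (σ : S → A) (hσ : ∀ s, σ s ∈ Aadv s)
    (Tσ : (S → A → ℝ) → (S → A → ℝ))
    (hTσ : ∀ Q s a, Tσ Q s a = R s a + γ * ∑ s', P s a s' * Q s' (σ s'))
    (Qσ : S → A → ℝ) (hQσ : Tσ Qσ = Qσ) :
    ∀ s a, Qb s a ≤ Qσ s a := by
  obtain ⟨s₀, hs₀⟩ := Finite.exists_max fun s => Qb s (σ s) - Qσ s (σ s)
  have key : ∀ s a, Qb s a - Qσ s a ≤ γ * (Qb s₀ (σ s₀) - Qσ s₀ (σ s₀)) := by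
    intro s a
    have hb := hT Qb s a
    have hq := hTσ Qσ s a
    rw [hQb] at hb
    rw [hQσ] at hq
    rw [hb, hq, add_sub_add_left_eq_sub, ← mul_sub, ← Finset.sum_sub_distrib]
    refine mul_le_mul_of_nonneg_left ?_ hγ0
    calc ∑ s', (P s a s' * (Aadv s').inf' (hAadv s') (Qb s') - P s a s' * Qσ s' (σ s'))
        ≤ ∑ s', P s a s' * (Qb s₀ (σ s₀) - Qσ s₀ (σ s₀)) := by
          refine Finset.sum_le_sum fun s' _ => ?_
          rw [← mul_sub]
          refine mul_le_mul_of_nonneg_left ?_ (hP0 s a s')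
          exact (sub_le_sub_right (Finset.inf'_le _ (hσ s')) _).trans (hs₀ s')
      _ = Qb s₀ (σ s₀) - Qσ s₀ (σ s₀) := by rw [← Finset.sum_mul, hP1, one_mul]
  have hM : Qb s₀ (σ s₀) - Qσ s₀ (σ s₀) ≤ 0 := by
    nlinarith [key s₀ (σ s₀)]
  intro s a
  exact sub_nonpos.mp ((key s a).trans (mul_nonpos_of_nonneg_of_nonpos hγ0 hM))
end

section
/- Let Q̲ be the unique fixed point of the worst-attack Bellman operator T̲. Then for every (s,a) ∈ S × A, Q̲(s,a) = min over all admissible selectors σ : S → A (i.e., σ(s') ∈ A_adv(s') for all s') of Q^σ(s,a), where Q^σ is the unique fixed point of the policy-evaluation operator T_σ. That is, the fixed point of the worst-attack Bellman operator equals the worst-attack action value: the minimal discounted cumulative reward achievable by any admissible stationary attacker, simultaneously for all state-action pairs. -/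
open Finset

/-- A function on state-action pairs that dominates a discounted average of its own values
along a selector is nonnegative. -/
theorem nonneg_of_discounted_average_le {S A : Type*} [Fintype S] [Finite A]
    {P : S → A → S → ℝ} {γ : ℝ} {D : S → A → ℝ} {σ : S → A}
    (hP0 : ∀ s a s', 0 ≤ P s a s') (hP1 : ∀ s a, ∑ s', P s a s' = 1)
    (hγ0 : 0 ≤ γ) (hγ1 : γ < 1)
    (hD : ∀ s a, γ * ∑ s', P s a s' * D s' (σ s') ≤ D s a) (s : S) (a : A) :
    0 ≤ D s a := by
  have : Nonempty (S × A) := ⟨(s, a)⟩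
  obtain ⟨⟨s₀, a₀⟩, hmin⟩ := Finite.exists_min fun p : S × A => D p.1 p.2
  have hmin' : ∀ s a, D s₀ a₀ ≤ D s a := fun s a => hmin (s, a)
  have hsum : D s₀ a₀ ≤ ∑ s', P s₀ a₀ s' * D s' (σ s') := by
    calc D s₀ a₀ = ∑ s', P s₀ a₀ s' * D s₀ a₀ := by rw [← Finset.sum_mul, hP1, one_mul]
      _ ≤ _ := Finset.sum_le_sum fun s' _ =>
        mul_le_mul_of_nonneg_left (hmin' s' (σ s')) (hP0 s₀ a₀ s')
  have hdisc : γ * D s₀ a₀ ≤ D s₀ a₀ :=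
    (mul_le_mul_of_nonneg_left hsum hγ0).trans (hD s₀ a₀)
  have hnonneg : 0 ≤ D s₀ a₀ := by nlinarith
  exact hnonneg.trans (hmin' s a)

/-- The fixed point of the worst-attack Bellman operator equals, at every state-action
pair, the minimum over all admissible stationary attackers `σ` of the value `Q^σ(s,a)`,
where `Q^σ` is the fixed point of the policy-evaluation operator `T_σ`. -/
theorem worstAttackFixedPoint_eq_min_over_attackers
    {S A : Type*} [Fintype S] [Fintype A] [Nonempty S] [Nonempty A]
    (P : S → A → S → ℝ) (R : S → A → ℝ) (γ : ℝ)
    (hP0 : ∀ s a s', 0 ≤ P s a s') (hP1 : ∀ s a, ∑ s', P s a s' = 1)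
    (hγ0 : 0 ≤ γ) (hγ1 : γ < 1)
    (Aadv : S → Finset A) (hAadv : ∀ s, (Aadv s).Nonempty)
    (T : (S → A → ℝ) → (S → A → ℝ))
    (hT : ∀ Q s a, T Q s a =
      R s a + γ * ∑ s', P s a s' * (Aadv s').inf' (hAadv s') (Q s'))
    (Qb : S → A → ℝ) (hQb : T Qb = Qb)
    (Tsel : (S → A) → (S → A → ℝ) → (S → A → ℝ))
    (hTsel : ∀ σ Q s a, Tsel σ Q s a = R s a + γ * ∑ s', P s a s' * Q s' (σ s')) :
    ∀ s a, IsLeast {x : ℝ | ∃ σ : S → A, (∀ s', σ s' ∈ Aadv s') ∧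
      ∃ Qσ : S → A → ℝ, Tsel σ Qσ = Qσ ∧ x = Qσ s a} (Qb s a) := by
  have hfix : ∀ s a, Qb s a =
      R s a + γ * ∑ s', P s a s' * (Aadv s').inf' (hAadv s') (Qb s') := fun s a => by
    rw [← hT, hQb]
  intro s a
  constructor
  · choose σ hσ hmin using fun s' => (Aadv s').exists_mem_eq_inf' (hAadv s') (Qb s')
    refine ⟨σ, hσ, Qb, ?_, rfl⟩
    funext s a
    rw [hTsel, hfix s a]
    simp only [hmin]
  · rintro _ ⟨σ, hσ, Qσ, hQσ, rfl⟩
    have hval : ∀ s a, Qσ s a = R s a + γ * ∑ s', P s a s' * Qσ s' (σ s') := fun s a => by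
      rw [← hTsel, hQσ]
    refine sub_nonneg.mp <| nonneg_of_discounted_average_le
      (D := fun s a => Qσ s a - Qb s a) (σ := σ) hP0 hP1 hγ0 hγ1 (fun s a => ?_) s a
    rw [hval s a, hfix s a, add_sub_add_left_eq_sub, ← mul_sub, ← Finset.sum_sub_distrib]
    refine mul_le_mul_of_nonneg_left (Finset.sum_le_sum fun s' _ => ?_) hγ0
    rw [← mul_sub]
    exact mul_le_mul_of_nonneg_left
      (sub_le_sub_left (Finset.inf'_le (Qb s') (hσ s')) _) (hP0 s a s')
end

section
/- Suppose A_adv and Â_adv are two assignments of nonempty adversarial action sets with A_adv(s) ⊆ Â_adv(s) for every state s, and let Q̲ and Q̂ be the unique fixed points of the corresponding worst-attack Bellman operators. Then Q̂(s,a) ≤ Q̲(s,a) for all (s,a) ∈ S × A. In particular, replacing the true adversarially achievable action set by any superset of it (e.g., one obtained from a convex relaxation of the policy network) yields a pointwise lower bound on the worst-attack action value. -/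
open Finset

/-- Enlarging the adversarial action sets can only decrease the worst-attack action
value: if `A_adv(s) ⊆ Â_adv(s)` for every `s`, and `Q̲`, `Q̂` are the fixed points of
the corresponding worst-attack Bellman operators, then `Q̂ ≤ Q̲` pointwise. -/
theorem worstAttackFixedPoint_antitone_in_advSet
    {S A : Type*} [Fintype S] [Fintype A] [Nonempty S] [Nonempty A]
    (P : S → A → S → ℝ) (R : S → A → ℝ) (γ : ℝ)
    (hP0 : ∀ s a s', 0 ≤ P s a s') (hP1 : ∀ s a, ∑ s', P s a s' = 1)
    (hγ0 : 0 ≤ γ) (hγ1 : γ < 1)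
    (Aadv : S → Finset A) (hAadv : ∀ s, (Aadv s).Nonempty)
    (Ahat : S → Finset A) (hAhat : ∀ s, (Ahat s).Nonempty)
    (hsub : ∀ s, Aadv s ⊆ Ahat s)
    (T : (S → A → ℝ) → (S → A → ℝ))
    (hT : ∀ Q s a, T Q s a =
      R s a + γ * ∑ s', P s a s' * (Aadv s').inf' (hAadv s') (Q s'))
    (That : (S → A → ℝ) → (S → A → ℝ))
    (hThat : ∀ Q s a, That Q s a =
      R s a + γ * ∑ s', P s a s' * (Ahat s').inf' (hAhat s') (Q s'))
    (Qb : S → A → ℝ) (hQb : T Qb = Qb)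
    (Qhat : S → A → ℝ) (hQhat : That Qhat = Qhat) :
    ∀ s a, Qhat s a ≤ Qb s a := by
  obtain ⟨⟨s₀, a₀⟩, hmax⟩ :=
    Finite.exists_max fun p : S × A => Qhat p.1 p.2 - Qb p.1 p.2
  set M := Qhat s₀ a₀ - Qb s₀ a₀ with hM
  have hle : ∀ s a, Qhat s a ≤ Qb s a + M := fun s a => by
    have := hmax (s, a)
    dsimp only at this
    linarith
  have hinf : ∀ s, (Ahat s).inf' (hAhat s) (Qhat s) ≤
      (Aadv s).inf' (hAadv s) (Qb s) + M := fun s => by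
    obtain ⟨b, hb, hb_eq⟩ := (Aadv s).exists_mem_eq_inf' (hAadv s) (Qb s)
    rw [hb_eq]
    exact (Finset.inf'_le _ (hsub s hb)).trans (hle s b)
  have hsum : ∑ s', P s₀ a₀ s' * (Ahat s').inf' (hAhat s') (Qhat s') ≤
      ∑ s', P s₀ a₀ s' * (Aadv s').inf' (hAadv s') (Qb s') + M := by
    calc
      _ ≤ ∑ s', P s₀ a₀ s' * ((Aadv s').inf' (hAadv s') (Qb s') + M) :=
        Finset.sum_le_sum fun s' _ => mul_le_mul_of_nonneg_left (hinf s') (hP0 s₀ a₀ s')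
      _ = _ := by
        simp only [mul_add, Finset.sum_add_distrib, ← Finset.sum_mul, hP1, one_mul]
  have hQb₀ := hT Qb s₀ a₀
  have hQhat₀ := hThat Qhat s₀ a₀
  rw [hQb] at hQb₀
  rw [hQhat] at hQhat₀
  have hcontract : M ≤ γ * M := by
    have := mul_le_mul_of_nonneg_left hsum hγ0
    rw [mul_add] at this
    linarith
  have hM_nonpos : M ≤ 0 := by nlinarith
  intro s a
  linarith [hle s a]
end
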